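/- Let β > 0, let {m_n} be a sequence of positive integers with m_n/n → β, and let Q, Q_1, Q_2, … be probability measures on {0,1,2,…} with Q_n supported on {0,1,…,m_n}, such that Q_n(t) → Q(t) for every t ≥ 0 and Σ_{t≥1} t·Q_n(t) → Σ_{t≥1} t·Q(t) < ∞ as n → ∞. Let D_n denote the degree of vertex 1 in the random intersection graph G(n, m_n, Q_n). Then for every fixed k = 0,1,2,…, as n → ∞, P(D_n = k) → Σ_{t≥0} ((a t)^k / k!)·e^{−a t}·Q(t), where a = β^{−1} Σ_{t≥0} t·Q(t). -/

import Mathlib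

open Filter MeasureTheory

lemma aux_scheffe (q : ℕ → ℕ → ℝ) (q0 : ℕ → ℝ) (hq : ∀ n s, 0 ≤ q n s) (hq0 : ∀ s, 0 ≤ q0 s)
    (hs : ∀ n, Summable (q n)) (hs0 : Summable q0)
    (hc : ∀ s, Tendsto (fun n => q n s) atTop (nhds (q0 s)))
    (ht : Tendsto (fun n => ∑' s, q n s) atTop (nhds (∑' s, q0 s)))
    (f : ℕ → ℕ → ℝ) (f0 : ℕ → ℝ) (C : ℝ)
    (hf : ∀ᶠ n in atTop, ∀ s, |f n s| ≤ C)
    (hfc : ∀ s, Tendsto (fun n => f n s) atTop (nhds (f0 s))) :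
    Tendsto (fun n => ∑' s, q n s * f n s) atTop (nhds (∑' s, q0 s * f0 s)) := by
  have hmin : Tendsto (fun n => ∑' s, min (q n s) (q0 s)) atTop (nhds (∑' s, q0 s)) := by
    refine tendsto_tsum_of_dominated_convergence (bound := q0) hs0 ?_ ?_
    · intro s
      simpa using (hc s).min (tendsto_const_nhds (x := q0 s))
    · refine Eventually.of_forall fun n s => ?_
      rw [Real.norm_eq_abs, abs_of_nonneg (le_min (hq n s) (hq0 s))]
      exact min_le_right _ _
  have hsm : ∀ n, Summable (fun s => min (q n s) (q0 s)) := fun n =>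
    Summable.of_nonneg_of_le (fun s => le_min (hq n s) (hq0 s)) (fun s => min_le_right _ _) hs0
  have habs : ∀ n s, |q n s - q0 s| = q n s + q0 s - 2 * min (q n s) (q0 s) := by
    intro n s
    rcases le_total (q n s) (q0 s) with h | h
    · rw [min_eq_left h, abs_of_nonpos (by linarith)]; ring
    · rw [min_eq_right h, abs_of_nonneg (by linarith)]; ring
  have hsabs : ∀ n, Summable (fun s => |q n s - q0 s|) := fun n => ((hs n).sub hs0).abs
  have hL1 : Tendsto (fun n => ∑' s, |q n s - q0 s|) atTop (nhds 0) := by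
    have : (fun n => ∑' s, |q n s - q0 s|) =
        fun n => (∑' s, q n s) + (∑' s, q0 s) - 2 * ∑' s, min (q n s) (q0 s) := by
      funext n
      simp_rw [habs]
      rw [((hs n).add hs0).tsum_sub ((hsm n).mul_left 2), (hs n).tsum_add hs0, tsum_mul_left]
    rw [this]
    have := (ht.add (tendsto_const_nhds (x := ∑' s, q0 s))).sub (hmin.const_mul 2)
    convert this using 2
    ring
  have hq0f : Tendsto (fun n => ∑' s, q0 s * f n s) atTop (nhds (∑' s, q0 s * f0 s)) := by
    refine tendsto_tsum_of_dominated_convergence (bound := fun s => q0 s * C) (hs0.mul_right C) ?_ ?_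
    · intro s
      exact (hfc s).const_mul _
    · filter_upwards [hf] with n hn s
      rw [Real.norm_eq_abs, abs_mul, abs_of_nonneg (hq0 s)]
      exact mul_le_mul_of_nonneg_left (hn s) (hq0 s)
  have hdiff : Tendsto (fun n => ∑' s, (q n s - q0 s) * f n s) atTop (nhds 0) := by
    refine squeeze_zero_norm' (a := fun n => (∑' s, |q n s - q0 s|) * C) ?_ (by simpa using hL1.mul_const C)
    filter_upwards [hf] with n hn
    rw [← tsum_mul_right]
    refine tsum_of_norm_bounded ((hsabs n).mul_right C).hasSum fun s => ?_
    rw [Real.norm_eq_abs, abs_mul]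
    exact mul_le_mul_of_nonneg_left (hn s) (abs_nonneg _)
  have := hdiff.add hq0f
  rw [zero_add] at this
  refine this.congr' ?_
  filter_upwards [hf] with n hn
  have h1 : Summable (fun s => (q n s - q0 s) * f n s) := by
    refine Summable.of_norm_bounded ((hsabs n).mul_right C) fun s => ?_
    rw [Real.norm_eq_abs, abs_mul]
    exact mul_le_mul_of_nonneg_left (hn s) (abs_nonneg _)
  have h2 : Summable (fun s => q0 s * f n s) := by
    refine Summable.of_norm_bounded (hs0.mul_right C) fun s => ?_
    rw [Real.norm_eq_abs, abs_mul, abs_of_nonneg (hq0 s)]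
    exact mul_le_mul_of_nonneg_left (hn s) (hq0 s)
  rw [← h1.tsum_add h2]
  congr 1; funext s; ring

noncomputable def aux_r (m t s : ℕ) : ℝ := ((m - t).choose s : ℝ) / (m.choose s)

lemma aux_r_nonneg (m t s : ℕ) : 0 ≤ aux_r m t s := by unfold aux_r; positivity

lemma aux_r_le (m t s : ℕ) : aux_r m t s ≤ 1 := by
  unfold aux_r
  apply div_le_one_of_le₀ _ (by positivity)
  exact_mod_cast Nat.choose_le_choose s (Nat.sub_le m t)

lemma aux_r_succ (m t s : ℕ) (h : t < m) :
    aux_r m (t + 1) s = aux_r m t s * (1 - s / ((m : ℝ) - t)) := by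
  unfold aux_r
  obtain ⟨u, rfl⟩ : ∃ u, m = t + u + 1 := ⟨m - t - 1, by omega⟩
  have e1 : t + u + 1 - (t + 1) = u := by omega
  have e2 : t + u + 1 - t = u + 1 := by omega
  rw [e1, e2]
  have key : (u.choose s : ℝ) * (u + 1) = ((u + 1).choose s : ℝ) * (u + 1 - s) := by
    have := Nat.choose_mul_succ_eq u s
    rcases le_or_gt s (u + 1) with hs | hs
    · have h2 : (((u + 1 - s : ℕ)) : ℝ) = (u : ℝ) + 1 - s := by
        rw [Nat.cast_sub hs]; push_cast; ring
      rw [← h2]; exact_mod_cast this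
    · rw [Nat.choose_eq_zero_of_lt hs, Nat.choose_eq_zero_of_lt (by omega)]; simp
  have hu : (u : ℝ) + 1 ≠ 0 := by positivity
  have e3 : (((t + u + 1 : ℕ) : ℝ) - t) = u + 1 := by push_cast; ring
  rw [e3]
  have : (u.choose s : ℝ) = ((u + 1).choose s : ℝ) * (1 - s / (u + 1)) := by
    field_simp; linarith
  rw [this]; ring

lemma aux_r_bound (m s t : ℕ) (h : t < m) :
    1 - aux_r m t s ≤ t * s / ((m : ℝ) - t) ∨ m.choose s = 0 := by
  by_cases h0 : m.choose s = 0
  · exact Or.inr h0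
  left
  induction t with
  | zero =>
    have : (m.choose s : ℝ) ≠ 0 := by exact_mod_cast h0
    simp [aux_r, this]
  | succ t ih =>
    have ih := ih (by omega)
    rw [aux_r_succ m t s (by omega)]
    have hm : (t : ℝ) + 1 < m := by exact_mod_cast h
    have h1 : aux_r m t s * (s / ((m : ℝ) - t)) ≤ s / ((m : ℝ) - t) :=
      mul_le_of_le_one_left (div_nonneg (by positivity) (by linarith)) (aux_r_le m t s)
    have h2 : (s : ℝ) / ((m : ℝ) - t) ≤ s / ((m : ℝ) - (t + 1)) :=
      div_le_div_of_nonneg_left (by positivity) (by linarith) (by linarith)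
    have h3 : (t * s : ℝ) / ((m : ℝ) - t) ≤ t * s / ((m : ℝ) - (t + 1)) :=
      div_le_div_of_nonneg_left (by positivity) (by linarith) (by linarith)
    push_cast
    have : ((t : ℝ) + 1) * s / ((m : ℝ) - (t + 1)) = t * s / ((m : ℝ) - (t + 1)) + s / ((m : ℝ) - (t + 1)) := by ring
    rw [this]
    linarith

lemma aux_r_lim (s t : ℕ) :
    Tendsto (fun m : ℕ => (m : ℝ) * (1 - aux_r m t s)) atTop (nhds (t * s)) := by
  induction t with
  | zero =>
    refine (tendsto_congr' ?_).mpr tendsto_const_nhds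
    filter_upwards [eventually_ge_atTop s] with m hm
    have : (m.choose s : ℝ) ≠ 0 := by exact_mod_cast (Nat.choose_pos hm).ne'
    simp [aux_r, this]
  | succ t ih =>
    have h0 := ProbabilityTheory.tendsto_zero_of_tendsto_mul_atTop ih
    have h1 : Tendsto (fun m => aux_r m t s) atTop (nhds 1) := by
      simpa using (tendsto_const_nhds (x := (1 : ℝ))).sub h0
    have h2 : Tendsto (fun m : ℕ => (m : ℝ) / ((m : ℝ) - t)) atTop (nhds 1) := by
      simpa [sub_eq_add_neg] using tendsto_natCast_div_add_atTop (𝕜 := ℝ) (-(t : ℝ))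
    have := ih.add ((h1.mul h2).mul_const (s : ℝ))
    have e : (t : ℝ) * s + 1 * 1 * s = ((t + 1 : ℕ) : ℝ) * s := by push_cast; ring
    rw [e] at this
    refine this.congr' ?_
    filter_upwards [eventually_gt_atTop t] with m hm
    rw [aux_r_succ m t s hm]
    ring

noncomputable def aux_p (m : ℕ) (q : ℕ → ℝ) (t : ℕ) : ℝ := ∑' s, q s * (1 - aux_r m t s)

lemma aux_summable (m : ℕ) (q : ℕ → ℝ) (hsupp : ∀ t, m < t → q t = 0) (g : ℕ → ℝ) :
    Summable (fun t => q t * g t) := by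
  apply summable_of_ne_finset_zero (s := Finset.range (m + 1))
  intro b hb
  rw [hsupp b (by simpa using hb)]; simp

lemma aux_p_mem (m : ℕ) (q : ℕ → ℝ) (hq : ∀ t, 0 ≤ q t) (hsum : ∑' t, q t = 1)
    (hsupp : ∀ t, m < t → q t = 0) (t : ℕ) : 0 ≤ aux_p m q t ∧ aux_p m q t ≤ 1 := by
  constructor
  · exact tsum_nonneg fun s => mul_nonneg (hq s) (by linarith [aux_r_le m t s])
  · rw [← hsum]
    refine Summable.tsum_le_tsum (fun s => ?_) (aux_summable m q hsupp _)
      (by simpa using aux_summable m q hsupp (fun _ => 1))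
    exact mul_le_of_le_one_right (hq s) (by linarith [aux_r_nonneg m t s])

lemma aux_p_lim (β : ℝ) (m : ℕ → ℕ) (hm : Tendsto m atTop atTop)
    (hmn : Tendsto (fun n : ℕ => (n : ℝ) / m n) atTop (nhds β⁻¹))
    (Q : ℕ → ℝ) (Qn : ℕ → ℕ → ℝ)
    (hQ : ∀ t, 0 ≤ Q t) (hQn : ∀ n t, 0 ≤ Qn n t) 
    (hsupp : ∀ n t, m n < t → Qn n t = 0)
    (hconv : ∀ t, Tendsto (fun n => Qn n t) atTop (nhds (Q t)))
    (hmomQ : Summable fun t : ℕ => (t : ℝ) * Q t)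
    (hmom : Tendsto (fun n => ∑' t : ℕ, (t : ℝ) * Qn n t) atTop
      (nhds (∑' t : ℕ, (t : ℝ) * Q t))) (t : ℕ) :
    Tendsto (fun n : ℕ => (n : ℝ) * aux_p (m n) (Qn n) t) atTop
      (nhds ((β⁻¹ * ∑' s : ℕ, (s : ℝ) * Q s) * t)) := by
  -- truncated f
  let f : ℕ → ℕ → ℝ := fun n s => if s ≤ m n then (n : ℝ) * (1 - aux_r (m n) t s) / s else 0
  let f0 : ℕ → ℝ := fun s => β⁻¹ * (t * s) / s
  have h2 : Tendsto (fun n : ℕ => (m n : ℝ) / ((m n : ℝ) - t)) atTop (nhds 1) := by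
    have : Tendsto (fun m : ℕ => (m : ℝ) / ((m : ℝ) - t)) atTop (nhds 1) := by
      simpa [sub_eq_add_neg] using tendsto_natCast_div_add_atTop (𝕜 := ℝ) (-(t : ℝ))
    exact this.comp hm
  have h3 : Tendsto (fun n : ℕ => (n : ℝ) / ((m n : ℝ) - t) * t) atTop (nhds (β⁻¹ * t)) := by
    have := (hmn.mul h2).mul_const (t : ℝ)
    rw [mul_one] at this
    refine this.congr' ?_
    filter_upwards [hm.eventually_gt_atTop 0] with n hn
    have : (m n : ℝ) ≠ 0 := by positivity
    field_simp
  have key := aux_scheffe (fun n s => (s : ℝ) * Qn n s) (fun s => (s : ℝ) * Q s)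
    (fun n s => mul_nonneg (by positivity) (hQn n s)) (fun s => mul_nonneg (by positivity) (hQ s))
    (fun n => by simpa [mul_comm] using aux_summable (m n) (Qn n) (hsupp n) (fun s => (s : ℝ)))
    hmomQ (fun s => (hconv s).const_mul _) hmom f f0 (β⁻¹ * t + 1) ?_ ?_
  · have e : ∑' s : ℕ, ((s : ℝ) * Q s) * f0 s = (β⁻¹ * ∑' s : ℕ, (s : ℝ) * Q s) * t := by
      rw [mul_comm β⁻¹, mul_assoc, ← tsum_mul_right]
      congr 1; funext s
      rcases eq_or_ne s 0 with rfl | hs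
      · simp
      · have : (s : ℝ) ≠ 0 := by positivity
        simp only [f0]; field_simp
    rw [e] at key
    refine key.congr fun n => ?_
    unfold aux_p
    rw [← tsum_mul_left]
    congr 1; funext s
    rcases eq_or_ne s 0 with rfl | hs
    · simp [aux_r]
    · have : (s : ℝ) ≠ 0 := by positivity
      simp only [f]
      split_ifs with h
      · field_simp
      · rw [hsupp n s (by omega)]; simp
  · filter_upwards [h3.eventually_le_const (by linarith : β⁻¹ * t < β⁻¹ * t + 1),
      hm.eventually_gt_atTop t] with n hn hmt s
    have hmt' : (0 : ℝ) < (m n : ℝ) - t := by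
      have : (t : ℝ) < m n := by exact_mod_cast hmt
      linarith
    have hpos : 0 ≤ β⁻¹ * t + 1 := le_trans (by positivity) hn
    simp only [f]
    split_ifs with h
    · rcases eq_or_ne s 0 with rfl | hs
      · simpa using hpos
      have hs' : (0 : ℝ) < s := by positivity
      rw [abs_of_nonneg (by
        have := aux_r_le (m n) t s
        apply div_nonneg (mul_nonneg (by positivity) (by linarith)) hs'.le)]
      rcases aux_r_bound (m n) s t hmt with hb | hb
      · refine le_trans ?_ hn
        rw [div_le_iff₀ hs']
        calc (n : ℝ) * (1 - aux_r (m n) t s) ≤ n * (t * s / ((m n : ℝ) - t)) := by gcongr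
          _ = _ := by ring
      · exact absurd hb (Nat.choose_pos h).ne'
    · simpa using hpos
  · intro s
    have h4 : Tendsto (fun n : ℕ => (n : ℝ) / m n * ((m n : ℝ) * (1 - aux_r (m n) t s)) / s) atTop
        (nhds (f0 s)) := by
      exact (hmn.mul ((aux_r_lim s t).comp hm)).div_const _
    refine h4.congr' ?_
    filter_upwards [hm.eventually_ge_atTop s, hm.eventually_gt_atTop 0] with n hn hn0
    simp only [f, if_pos hn]
    have : (m n : ℝ) ≠ 0 := by positivity
    field_simp

lemma aux_binom_le (N k : ℕ) (p : ℝ) (h0 : 0 ≤ p) (h1 : p ≤ 1) :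
    |(N.choose k : ℝ) * p ^ k * (1 - p) ^ (N - k)| ≤ 1 := by
  have hq : 0 ≤ 1 - p := by linarith
  rw [abs_of_nonneg (by positivity)]
  rcases le_or_gt k N with h | h
  · have := add_pow p (1 - p) N
    rw [add_sub_cancel, one_pow] at this
    refine le_trans (le_of_eq ?_) (le_trans (Finset.single_le_sum (f := fun j => p ^ j * (1 - p) ^ (N - j) * (N.choose j : ℝ))
      (fun i _ => by positivity) (Finset.mem_range.2 (Nat.lt_succ_of_le h))) this.symm.le)
    ring
  · rw [Nat.choose_eq_zero_of_lt h]; simp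

lemma aux_count {α : Type*} [Fintype α] [DecidableEq α] (N k : ℕ) (w : α → ℝ) (R : α → Prop) [DecidablePred R] :
    ∑ A : Fin N → α, (if (Finset.univ.filter (fun j => R (A j))).card = k then ∏ j, w (A j) else 0)
      = (N.choose k : ℝ) * (∑ a with R a, w a) ^ k * (∑ a with ¬ R a, w a) ^ (N - k) := by
  set p := ∑ a with R a, w a
  set q := ∑ a with ¬ R a, w a
  have h1 : ∀ J : Finset (Fin N), ∑ A : Fin N → α,
      (if (Finset.univ.filter (fun j => R (A j))) = J then ∏ j, w (A j) else 0)
      = p ^ J.card * q ^ (N - J.card) := by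
    intro J
    have h2 : ∏ j : Fin N, (∑ a with (R a ↔ j ∈ J), w a) = p ^ J.card * q ^ (N - J.card) := by
      have : ∀ j : Fin N, (∑ a with (R a ↔ j ∈ J), w a) = if j ∈ J then p else q := by
        intro j
        split_ifs with h <;> simp [h, p, q]
      simp_rw [this]
      rw [Finset.prod_ite]
      simp only [Finset.prod_const]
      congr 2
      · simp
      · rw [← Finset.compl_filter, Finset.card_compl]; simp
    rw [← h2, Finset.prod_univ_sum, ← Finset.sum_filter]
    apply Finset.sum_congr _ (fun _ _ => rfl)
    ext A
    simp [Fintype.mem_piFinset, Finset.ext_iff]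
  calc _ = ∑ A : Fin N → α, ∑ J ∈ (Finset.univ : Finset (Fin N)).powersetCard k,
        (if (Finset.univ.filter (fun j => R (A j))) = J then ∏ j, w (A j) else 0) := by
        refine Finset.sum_congr rfl fun A _ => ?_
        rw [Finset.sum_ite_eq]
        simp [Finset.mem_powersetCard]
    _ = ∑ J ∈ (Finset.univ : Finset (Fin N)).powersetCard k, p ^ k * q ^ (N - k) := by
        rw [Finset.sum_comm]
        refine Finset.sum_congr rfl fun J hJ => ?_
        rw [h1, (Finset.mem_powersetCard.1 hJ).2]
    _ = _ := by simp [mul_assoc]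

noncomputable def aux_w (m : ℕ) (q : ℕ → ℝ) (s : ℕ) : ℝ := q s / (m.choose s)

lemma aux_tsum (m : ℕ) (q : ℕ → ℝ) (hsupp : ∀ t, m < t → q t = 0) (g : ℕ → ℝ) :
    ∑ A : Finset (Fin m), aux_w m q A.card * g A.card = ∑' t, q t * g t := by
  rw [tsum_eq_sum (s := Finset.range (m + 1)) (fun b hb => by
    rw [hsupp b (by simpa using hb)]; simp)]
  have := Finset.sum_powerset_apply_card (fun t => aux_w m q t * g t) (x := (Finset.univ : Finset (Fin m)))
  rw [Finset.powerset_univ, Finset.card_univ, Fintype.card_fin] at this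
  rw [this]
  refine Finset.sum_congr rfl fun t ht => ?_
  have : (m.choose t : ℝ) ≠ 0 := by
    exact_mod_cast (Nat.choose_pos (Nat.lt_succ_iff.1 (Finset.mem_range.1 ht))).ne'
  rw [aux_w, nsmul_eq_mul]; field_simp

lemma aux_compl (m : ℕ) (q : ℕ → ℝ) (hsum : ∑' t, q t = 1) (hsupp : ∀ t, m < t → q t = 0)
    (B : Finset (Fin m)) :
    ∑ A with ¬ (B ∩ A).Nonempty, aux_w m q A.card = 1 - aux_p m q B.card := by
  have h1 : aux_p m q B.card = 1 - ∑' s, q s * aux_r m B.card s := by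
    rw [aux_p, ← hsum, ← Summable.tsum_sub (by simpa using aux_summable m q hsupp (fun _ => 1))
      (aux_summable m q hsupp _)]
    congr 1; funext s; rw [hsum]; ring
  rw [h1, sub_sub_cancel]
  have h2 : (Finset.univ.filter fun A : Finset (Fin m) => ¬ (B ∩ A).Nonempty) = Bᶜ.powerset := by
    ext A
    simp only [Finset.mem_filter, Finset.mem_univ, true_and, Finset.mem_powerset,
      Finset.not_nonempty_iff_eq_empty, ← Finset.disjoint_iff_inter_eq_empty]
    rw [Finset.subset_compl_comm, Finset.subset_compl_iff_disjoint_right]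
  rw [h2, Finset.sum_powerset_apply_card (fun t => aux_w m q t), Finset.card_compl, Fintype.card_fin]
  rw [tsum_eq_sum (s := Finset.range (m - B.card + 1)) (fun b hb => by
    rw [aux_r, Nat.choose_eq_zero_of_lt (by simpa using hb)]; simp)]
  refine Finset.sum_congr rfl fun t ht => ?_
  rw [aux_w, aux_r, nsmul_eq_mul]; ring

lemma aux_inter (m : ℕ) (q : ℕ → ℝ) (hsum : ∑' t, q t = 1) (hsupp : ∀ t, m < t → q t = 0)
    (B : Finset (Fin m)) :
    ∑ A with (B ∩ A).Nonempty, aux_w m q A.card = aux_p m q B.card := by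
  have h := Finset.sum_filter_add_sum_filter_not Finset.univ
    (fun A : Finset (Fin m) => (B ∩ A).Nonempty) (fun A => aux_w m q A.card)
  rw [aux_compl m q hsum hsupp] at h
  have h2 := aux_tsum m q hsupp (fun _ => 1)
  simp only [mul_one, hsum] at h2
  linarith

lemma aux_prob (N m k : ℕ) (q : ℕ → ℝ) (hq : ∀ t, 0 ≤ q t) (hsum : ∑' t, q t = 1)
    (hsupp : ∀ t, m < t → q t = 0)
    (Ω : Type) [MeasurableSpace Ω] (P : Measure Ω) [IsProbabilityMeasure P]
    (S : Fin (N + 1) → Ω → Finset (Fin m))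
    (hSmeas : ∀ (i : Fin (N + 1)) (A : Finset (Fin m)), MeasurableSet {ω | S i ω = A})
    (hdist : ∀ (i : Fin (N + 1)) (A : Finset (Fin m)),
      P {ω | S i ω = A} = ENNReal.ofReal (q A.card / m.choose A.card))
    (hindep : ∀ (A : Fin (N + 1) → Finset (Fin m)),
      P {ω | ∀ i, S i ω = A i} = ∏ i, P {ω | S i ω = A i})
    (D : Ω → ℕ)
    (hD : ∀ (ω : Ω), D ω = (Finset.univ.filter (fun j : Fin (N + 1) =>
        j ≠ 0 ∧ (S 0 ω ∩ S j ω).Nonempty)).card) :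
    (P {ω | D ω = k}).toReal = ∑' t, q t *
      ((N.choose k : ℝ) * (aux_p m q t) ^ k * (1 - aux_p m q t) ^ (N - k)) := by
  classical
  let deg : (Fin (N + 1) → Finset (Fin m)) → ℕ := fun A =>
    (Finset.univ.filter (fun j : Fin (N + 1) => j ≠ 0 ∧ (A 0 ∩ A j).Nonempty)).card
  have hset : {ω | D ω = k} = ⋃ A ∈ Finset.univ.filter (fun A => deg A = k),
      {ω | ∀ i, S i ω = A i} := by
    ext ω
    simp only [Set.mem_setOf_eq, Set.mem_iUnion, Finset.mem_filter, Finset.mem_univ, true_and,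
      exists_prop]
    constructor
    · intro h
      exact ⟨fun i => S i ω, by rw [← h, hD], fun i => rfl⟩
    · rintro ⟨A, hA, h⟩
      have : A = fun i => S i ω := by funext i; exact (h i).symm
      rw [← hA, hD, this]
  rw [hset, measure_biUnion_finset]
  · rw [ENNReal.toReal_sum (fun _ _ => measure_ne_top _ _)]
    have h1 : ∀ A : Fin (N + 1) → Finset (Fin m), (P {ω | ∀ i, S i ω = A i}).toReal =
        ∏ i, aux_w m q (A i).card := by
      intro A
      rw [hindep, ENNReal.toReal_prod]
      refine Finset.prod_congr rfl fun i _ => ?_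
      rw [hdist, ENNReal.toReal_ofReal (div_nonneg (hq _) (by positivity)), aux_w]
    simp_rw [h1]
    rw [Finset.sum_filter, ← (Fin.consEquiv (fun _ : Fin (N + 1) => Finset (Fin m))).sum_comp,
      Fintype.sum_prod_type, ← aux_tsum m q hsupp]
    refine Finset.sum_congr rfl fun B _ => ?_
    rw [← aux_inter m q hsum hsupp B]
    have h3 := aux_compl m q hsum hsupp B
    rw [← aux_inter m q hsum hsupp B] at h3
    rw [← h3, ← aux_count N k (fun A : Finset (Fin m) => aux_w m q A.card) (fun A => (B ∩ A).Nonempty),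
      Finset.mul_sum]
    refine Finset.sum_congr rfl fun A _ => ?_
    have h4 : deg (Fin.cons B A) = (Finset.univ.filter (fun j => (B ∩ A j).Nonempty)).card := by
      simp only [deg]
      rw [Fin.univ_succ, Finset.filter_cons, if_neg (by simp), Finset.filter_map, Finset.card_map]
      congr 1
      ext j
      simp
    have h5 : (Fin.consEquiv (fun _ : Fin (N + 1) => Finset (Fin m))) (B, A) = Fin.cons B A := rfl
    rw [h5, h4, Fin.prod_univ_succ]
    simp
  · intro A _ A' _ hne
    refine Set.disjoint_left.2 fun ω h h' => hne ?_
    funext i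
    exact (h i).symm.trans (h' i)
  · intro A _
    rw [Set.setOf_forall]
    exact MeasurableSet.iInter fun i => hSmeas i _



/-- **Proposition 1** (Bloznelis 2010): asymptotic degree distribution in the sparse
inhomogeneous random intersection graph `G(n, mₙ, Qₙ)`.  Here `S n i` is the random
attribute set of vertex `i` (the sets are i.i.d. with `P(S = A) = Qₙ(|A|)/C(mₙ,|A|)`),
`D n` is the degree of the first vertex, and under `mₙ/n → β`, `Qₙ(t) → Q(t)` and
convergence of first moments, `P(Dₙ = k) → ∑_t ((at)^k/k!) e^{-at} Q(t)`
with `a = β⁻¹ ∑_t t·Q(t)`. -/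
theorem stmt_0
    (β : ℝ) (hβ : 0 < β)
    (m : ℕ → ℕ) (hmpos : ∀ n, 0 < m n)
    (hm : Tendsto (fun n => (m n : ℝ) / n) atTop (nhds β))
    (Q : ℕ → ℝ) (Qn : ℕ → ℕ → ℝ)
    (hQnonneg : ∀ t, 0 ≤ Q t) (hQsum : ∑' t, Q t = 1)
    (hQnnonneg : ∀ n t, 0 ≤ Qn n t) (hQnsum : ∀ n, ∑' t, Qn n t = 1)
    (hQnsupp : ∀ n t, m n < t → Qn n t = 0)
    (hconv : ∀ t, Tendsto (fun n => Qn n t) atTop (nhds (Q t)))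
    (hmomQ : Summable fun t : ℕ => (t : ℝ) * Q t)
    (hmom : Tendsto (fun n => ∑' t : ℕ, (t : ℝ) * Qn n t) atTop
      (nhds (∑' t : ℕ, (t : ℝ) * Q t)))
    (Ω : ℕ → Type) (mΩ : ∀ n, MeasurableSpace (Ω n))
    (P : ∀ n, Measure (Ω n)) (hP : ∀ n, IsProbabilityMeasure (P n))
    (S : ∀ n, Fin n → Ω n → Finset (Fin (m n)))
    (hSmeas : ∀ n (i : Fin n) (A : Finset (Fin (m n))),
      MeasurableSet {ω | S n i ω = A})
    (hdist : ∀ n (i : Fin n) (A : Finset (Fin (m n))),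
      P n {ω | S n i ω = A} = ENNReal.ofReal (Qn n A.card / (m n).choose A.card))
    (hindep : ∀ n (A : Fin n → Finset (Fin (m n))),
      P n {ω | ∀ i, S n i ω = A i} = ∏ i, P n {ω | S n i ω = A i})
    (D : ∀ n, Ω n → ℕ)
    (hD : ∀ n (h : 0 < n) (ω : Ω n),
      D n ω = (Finset.univ.filter (fun j : Fin n =>
        j ≠ ⟨0, h⟩ ∧ (S n ⟨0, h⟩ ω ∩ S n j ω).Nonempty)).card)
    (k : ℕ) :
    Tendsto (fun n => (P n {ω | D n ω = k}).toReal) atTop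
      (nhds (∑' t : ℕ,
        ((β⁻¹ * ∑' s : ℕ, (s : ℝ) * Q s) * t) ^ k / (Nat.factorial k) *
          Real.exp (-((β⁻¹ * ∑' s : ℕ, (s : ℝ) * Q s) * t)) * Q t)) := by
  rw [← tendsto_add_atTop_iff_nat 1]
  have hsh : Tendsto (fun N : ℕ => N + 1) atTop atTop := tendsto_add_atTop_nat 1
  have hm1 : Tendsto (fun N : ℕ => (m (N + 1) : ℝ) / ((N + 1 : ℕ) : ℝ)) atTop (nhds β) :=
    hm.comp hsh
  have hM2 : Tendsto (fun N : ℕ => (N : ℝ) / m (N + 1)) atTop (nhds β⁻¹) := by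
    have h1 := (tendsto_natCast_div_add_atTop (𝕜 := ℝ) 1).mul (hm1.inv₀ hβ.ne')
    rw [one_mul] at h1
    refine h1.congr fun N => ?_
    have : (m (N + 1) : ℝ) ≠ 0 := by exact_mod_cast (hmpos _).ne'
    push_cast
    field_simp
  have hM1 : Tendsto (fun N : ℕ => m (N + 1)) atTop atTop := by
    rw [← tendsto_natCast_atTop_iff (R := ℝ)]
    have h1 : Tendsto (fun N : ℕ => ((N + 1 : ℕ) : ℝ)) atTop atTop :=
      tendsto_natCast_atTop_atTop.comp hsh
    refine (hm1.pos_mul_atTop hβ h1).congr fun N => ?_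
    have : ((N + 1 : ℕ) : ℝ) ≠ 0 := by positivity
    field_simp
  have hQs : Summable Q := by
    by_contra h
    rw [tsum_eq_zero_of_not_summable h] at hQsum
    exact zero_ne_one hQsum
  have key := aux_scheffe (fun N => Qn (N + 1)) Q (fun N => hQnnonneg _) hQnonneg
    (fun N => by simpa using aux_summable _ (Qn (N + 1)) (hQnsupp _) (fun _ => 1)) hQs
    (fun s => (hconv s).comp hsh) (by simp [hQnsum, hQsum])
    (fun N t => (N.choose k : ℝ) * (aux_p (m (N + 1)) (Qn (N + 1)) t) ^ k *
      (1 - aux_p (m (N + 1)) (Qn (N + 1)) t) ^ (N - k))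
    (fun t => Real.exp (-((β⁻¹ * ∑' s : ℕ, (s : ℝ) * Q s) * t)) *
      ((β⁻¹ * ∑' s : ℕ, (s : ℝ) * Q s) * t) ^ k / (Nat.factorial k)) 1
    (Eventually.of_forall fun N t => by
      have := aux_p_mem (m (N + 1)) (Qn (N + 1)) (hQnnonneg _) (hQnsum _) (hQnsupp _) t
      exact aux_binom_le _ _ _ this.1 this.2)
    (fun t => ProbabilityTheory.tendsto_choose_mul_pow_of_tendsto_mul_atTop k
      (aux_p_lim β (fun N => m (N + 1)) hM1 hM2 Q (fun N => Qn (N + 1)) hQnonneg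
        (fun N => hQnnonneg _) (fun N => hQnsupp _) (fun s => (hconv s).comp hsh) hmomQ
        (hmom.comp hsh) t))
  have e : ∀ N : ℕ, (P (N + 1) {ω | D (N + 1) ω = k}).toReal =
      ∑' t, Qn (N + 1) t * ((N.choose k : ℝ) * (aux_p (m (N + 1)) (Qn (N + 1)) t) ^ k *
      (1 - aux_p (m (N + 1)) (Qn (N + 1)) t) ^ (N - k)) := fun N =>
    aux_prob N (m (N + 1)) k (Qn (N + 1)) (hQnnonneg _) (hQnsum _) (hQnsupp _) (Ω (N + 1))
      (P (N + 1)) (S (N + 1)) (hSmeas _) (hdist _) (hindep _) (D (N + 1))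
      (fun ω => hD (N + 1) (Nat.succ_pos N) ω)
  simp_rw [e]
  convert key using 2
  congr 1; funext t; ring
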